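/- Let G be a projection game and let {B_v^b} be a d-dimensional quantum strategy for the second player. For each u ∈ 𝒰 and a ∈ 𝒜 set B_u^a := Σ_v μ(v|u) Σ_{b:π_{uv}(b)=a} B_v^b, and for any family of d-dimensional POVMs A = {A_u^a}_{a∈𝒜} (one POVM for each u ∈ 𝒰) set val*(G,A,B) := ‖Σ_u μ(u) Σ_a conj(A_u^a) ⊗ B_u^a‖. Then (sup_A val*(G,A,B))² ≤ ‖Σ_u μ(u) Σ_a conj(B_u^a) ⊗ B_u^a‖ ≤ sup_A val*(G,A,B), where the supremum is over all families of d-dimensional POVMs for the first player. -/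

import Mathlib

noncomputable section
open scoped Kronecker ComplexOrder
open Matrix

/-- `d × d` complex matrices. -/
abbrev Mat (d : ℕ) := Matrix (Fin d) (Fin d) ℂ

/-- Entrywise complex conjugation of a matrix. -/
def mconj {m n : Type*} (M : Matrix m n ℂ) : Matrix m n ℂ := M.map (starRingEnd ℂ)

/-- Operator (spectral) norm of a square complex matrix. -/
noncomputable def opNorm {n : Type*} [Fintype n] [DecidableEq n] (M : Matrix n n ℂ) : ℝ :=
  ‖Matrix.toEuclideanCLM (𝕜 := ℂ) M‖

/-- `⟨ψ| M |ψ⟩`. -/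
def braket {ι : Type*} [Fintype ι] (ψ : ι → ℂ) (M : Matrix ι ι ℂ) : ℂ :=
  star ψ ⬝ᵥ M.mulVec ψ

/-- Squared Euclidean norm of a complex vector. -/
def enormSq {ι : Type*} [Fintype ι] (ψ : ι → ℂ) : ℝ := ∑ i, Complex.normSq (ψ i)

/-- A family of psd matrices summing to the identity. -/
def IsPOVM {d : ℕ} {α : Type*} [Fintype α] (M : α → Mat d) : Prop :=
  (∀ a, (M a).PosSemidef) ∧ (∑ a, M a) = 1

/-- A two-player one-round projection game. -/
structure ProjGame where
  U : Type
  V : Type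
  A : Type
  B : Type
  [fU : Fintype U]
  [fV : Fintype V]
  [fA : Fintype A]
  [fB : Fintype B]
  [dA : DecidableEq A]
  μ : U → V → ℝ
  μ_nonneg : ∀ u v, 0 ≤ μ u v
  μ_sum : ∑ u, ∑ v, μ u v = 1
  proj : U → V → B → Option A

attribute [instance] ProjGame.fU ProjGame.fV ProjGame.fA ProjGame.fB ProjGame.dA

namespace ProjGame

variable (G : ProjGame)

/-- Marginal distribution on first-player questions. -/
def μL (u : G.U) : ℝ := ∑ v, G.μ u v

/-- Marginal distribution on second-player questions. -/
def μR (v : G.V) : ℝ := ∑ u, G.μ u v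

/-- Conditional distribution `μ(v|u)`. -/
def μc (u : G.U) (v : G.V) : ℝ := G.μ u v / G.μL u

/-- A `d`-dimensional quantum strategy for the first player. -/
def IsStrategyA {d : ℕ} (A : G.U → G.A → Mat d) : Prop := ∀ u, IsPOVM (A u)

/-- A `d`-dimensional quantum strategy for the second player. -/
def IsStrategyB {d : ℕ} (B : G.V → G.B → Mat d) : Prop := ∀ v, IsPOVM (B v)

/-- Success probability of a pair of quantum strategies with shared state `ψ`. -/
def pay {d : ℕ} (A : G.U → G.A → Mat d) (B : G.V → G.B → Mat d)
    (ψ : Fin d × Fin d → ℂ) : ℝ :=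
  ∑ u, ∑ v, G.μ u v * ∑ a, ∑ b,
    if G.proj u v b = some a then (braket ψ (mconj (A u a) ⊗ₖ B v b)).re else 0

/-- The entangled value `val*(G)`. -/
noncomputable def entVal : ℝ :=
  sSup { x | ∃ (d : ℕ) (A : G.U → G.A → Mat d) (B : G.V → G.B → Mat d)
    (ψ : Fin d × Fin d → ℂ),
    G.IsStrategyA A ∧ G.IsStrategyB B ∧ enormSq ψ = 1 ∧ x = G.pay A B ψ }

/-- The operator `B_u^a = Σ_v μ(v|u) Σ_{b → a} B_v^b`. -/
def Bop {d : ℕ} (B : G.V → G.B → Mat d) (u : G.U) (a : G.A) : Mat d :=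
  ∑ v, ∑ b, if G.proj u v b = some a then (G.μc u v : ℂ) • B v b else 0

/-- The matrix `Σ_u μ(u) Σ_a conj(B_u^a) ⊗ B_u^a`. -/
def sqMat {d : ℕ} (B : G.V → G.B → Mat d) :
    Matrix (Fin d × Fin d) (Fin d × Fin d) ℂ :=
  ∑ u, (G.μL u : ℂ) • ∑ a, mconj (G.Bop B u a) ⊗ₖ G.Bop B u a

/-- The square norm `‖G‖*`. -/
noncomputable def sqNorm : ℝ :=
  sSup { x | ∃ (d : ℕ) (B : G.V → G.B → Mat d), G.IsStrategyB B ∧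
    x = Real.sqrt (opNorm (G.sqMat B)) }

/-- A vector quantum strategy over the finite measured space `Fin n`. -/
def IsVecStrategy {n d : ℕ} (A : Fin n → G.V → G.B → Mat d) : Prop :=
  ∀ i v, (∀ b, (A i v b).PosSemidef) ∧ ((1 : Mat d) - ∑ b, A i v b).PosSemidef

/-- The matrix `E_ω conj(A_{ωv}) ⊗ A_{ωv}` at a fixed `v`. -/
def vecMatAt {n d : ℕ} (w : Fin n → ℝ) (A : Fin n → G.V → G.B → Mat d) (v : G.V) :
    Matrix (Fin d × Fin d) (Fin d × Fin d) ℂ :=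
  ∑ i, (w i : ℂ) • (mconj (∑ b, A i v b) ⊗ₖ (∑ b, A i v b))

/-- The matrix appearing in the definition of `val₊*`. -/
def vecMat {n d : ℕ} (w : Fin n → ℝ) (A : Fin n → G.V → G.B → Mat d) :
    Matrix (Fin d × Fin d) (Fin d × Fin d) ℂ :=
  ∑ i, (w i : ℂ) • ∑ u, (G.μL u : ℂ) • ∑ a, ∑ v, ∑ v',
    ((G.μc u v * G.μc u v' : ℝ) : ℂ) • ∑ b, ∑ b',
      if G.proj u v b = some a ∧ G.proj u v' b' = some a then
        mconj (A i v b) ⊗ₖ A i v' b' else 0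

/-- The relaxed value `val₊*(G)`. -/
noncomputable def valPlus : ℝ :=
  sSup { x | ∃ (n d : ℕ) (w : Fin n → ℝ) (A : Fin n → G.V → G.B → Mat d),
    (∀ i, 0 < w i) ∧ G.IsVecStrategy A ∧
    (∀ v, Real.sqrt (opNorm (G.vecMatAt w A v)) ≤ 1) ∧
    x = opNorm (G.vecMat w A) }

/-- The product of two projection games. -/
def prod (H : ProjGame) : ProjGame where
  U := G.U × H.U
  V := G.V × H.V
  A := G.A × H.A
  B := G.B × H.B
  fU := inferInstance
  fV := inferInstance
  fA := inferInstance
  fB := inferInstance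
  dA := inferInstance
  μ := fun p q => G.μ p.1 q.1 * H.μ p.2 q.2
  μ_nonneg := fun p q => mul_nonneg (G.μ_nonneg _ _) (H.μ_nonneg _ _)
  μ_sum := by
    have h1 := G.μ_sum
    have h2 := H.μ_sum
    calc ∑ p : G.U × H.U, ∑ q : G.V × H.V, G.μ p.1 q.1 * H.μ p.2 q.2
        = ∑ p : G.U × H.U, (∑ v, G.μ p.1 v) * (∑ v', H.μ p.2 v') := by
          refine Finset.sum_congr rfl fun p _ => ?_
          rw [Fintype.sum_prod_type, Finset.sum_mul_sum]
      _ = (∑ u, ∑ v, G.μ u v) * (∑ u', ∑ v', H.μ u' v') := by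
          rw [Fintype.sum_prod_type, Finset.sum_mul_sum]
      _ = 1 := by rw [h1, h2, one_mul]
  proj := fun p q b =>
    (G.proj p.1 q.1 b.1).bind fun a => (H.proj p.2 q.2 b.2).map fun a' => (a, a')

/-- The `k`-fold repetition `G^{⊗k}` (junk value `G` at `k = 0`). -/
def pow : ℕ → ProjGame
  | 0 => G
  | 1 => G
  | (n+2) => G.prod (pow (n+1))

/-- The normalized Laplacian of the square of the constraint graph of `G`. -/
def lap [DecidableEq G.V] : Matrix G.V G.V ℝ :=
  1 - Matrix.of fun v v' =>
    (Real.sqrt (G.μR v))⁻¹ * (∑ u, G.μL u * G.μc u v * G.μc u v') * (Real.sqrt (G.μR v'))⁻¹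

end ProjGame

open scoped MatrixOrder Matrix.Norms.L2Operator

section Mconj

variable {n : Type*}

lemma mconj_mul [Fintype n] (M N : Matrix n n ℂ) : mconj (M * N) = mconj M * mconj N := by
  simp [mconj, Matrix.map_mul]

lemma trace_mconj [Fintype n] (M : Matrix n n ℂ) : (mconj M).trace = starRingEnd ℂ M.trace := by
  simp [mconj, Matrix.trace]

lemma mconj_smul_ofReal (r : ℝ) (M : Matrix n n ℂ) : mconj ((r : ℂ) • M) = (r : ℂ) • mconj M := by
  ext i j
  simp [mconj]

lemma mconj_sum {ι : Type*} [Fintype ι] (M : ι → Matrix n n ℂ) :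
    mconj (∑ i, M i) = ∑ i, mconj (M i) := by
  ext i j
  simp [mconj, Matrix.sum_apply]

lemma mconj_one [DecidableEq n] : mconj (1 : Matrix n n ℂ) = 1 := by
  simp [mconj]

lemma Matrix.PosSemidef.mconj {M : Matrix n n ℂ} (hM : M.PosSemidef) :
    (_root_.mconj M).PosSemidef := by
  have h : _root_.mconj M = M.transpose := by
    ext i j
    exact hM.1.apply j i
  rw [h]
  exact hM.transpose

end Mconj

section TraceNorm

variable {n : Type*} [Fintype n] [DecidableEq n]

/-- The operator norm of a positive semidefinite matrix is at most its trace. -/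
lemma Matrix.PosSemidef.norm_le_trace {N : Matrix n n ℂ} (hN : N.PosSemidef) :
    ‖N‖ ≤ N.trace.re := by
  have h1 : ‖N‖ = ‖fun i => ((hN.1.eigenvalues i : ℝ) : ℂ)‖ := by
    conv_lhs => rw [hN.1.spectral_theorem]
    have hU : (hN.1.eigenvectorUnitary : Matrix n n ℂ) ∈ unitary (Matrix n n ℂ) :=
      hN.1.eigenvectorUnitary.2
    rw [Unitary.conjStarAlgAut_apply, CStarRing.norm_mul_mem_unitary _ (Unitary.star_mem hU),
      CStarRing.norm_mem_unitary_mul _ hU, Matrix.l2_opNorm_diagonal]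
    rfl
  have h2 : N.trace.re = ∑ i, hN.1.eigenvalues i := by
    rw [hN.1.trace_eq_sum_eigenvalues]
    simp
  rw [h1, h2, pi_norm_le_iff_of_nonneg (Finset.sum_nonneg fun i _ => hN.eigenvalues_nonneg i)]
  intro i
  rw [Complex.norm_real, Real.norm_of_nonneg (hN.eigenvalues_nonneg i)]
  exact Finset.single_le_sum (fun j _ => hN.eigenvalues_nonneg j) (Finset.mem_univ i)

/-- The trace of a Hermitian matrix is at most the dimension times its operator norm. -/
lemma Matrix.IsHermitian.trace_re_le_card_mul_norm {N : Matrix n n ℂ} (hN : N.IsHermitian) :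
    N.trace.re ≤ Fintype.card n * ‖N‖ := by
  have h : N ≤ algebraMap ℝ (Matrix n n ℂ) ‖N‖ :=
    IsSelfAdjoint.le_algebraMap_norm_self (a := N) hN
  have h' := (Matrix.le_iff.1 h).trace_nonneg
  rw [Matrix.trace_sub, Algebra.algebraMap_eq_smul_one, Matrix.trace_smul, Matrix.trace_one] at h'
  have h2 := (Complex.le_def.1 h').1
  simp at h2
  linarith

lemma le_of_forall_pow_two_pow_le {x y C : ℝ} (hy : 0 ≤ y)
    (h : ∀ k : ℕ, x ^ 2 ^ k ≤ C * y ^ 2 ^ k) : x ≤ y := by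
  by_contra! hlt
  rcases hy.eq_or_lt with rfl | hy
  · have := h 0
    simp at this
    linarith
  · have h1 : 1 < x / y := (one_lt_div hy).2 hlt
    obtain ⟨k, hk⟩ := pow_unbounded_of_one_lt C h1
    have h2 : (x / y) ^ k ≤ (x / y) ^ 2 ^ k := pow_le_pow_right₀ h1.le Nat.lt_two_pow_self.le
    have h3 : (x / y) ^ 2 ^ k ≤ C := by
      rw [div_pow, div_le_iff₀ (by positivity)]
      exact h k
    linarith

end TraceNorm

section CauchySchwarz

universe u

variable {n : Type*} {ι : Type u} [Fintype n] [Fintype ι]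

/-- Equal powers of `∑ conj X ⊗ Y`, `∑ conj X ⊗ X` and `∑ conj Y ⊗ Y` are again of this form,
for a common pair of families. -/
lemma exists_kronecker_sum_pow [DecidableEq n] (X Y : ι → Matrix n n ℂ) (k : ℕ) :
    ∃ (J : Type u) (_ : Fintype J) (P Q : J → Matrix n n ℂ),
      (∑ i, mconj (X i) ⊗ₖ Y i) ^ k = ∑ j, mconj (P j) ⊗ₖ Q j ∧
      (∑ i, mconj (X i) ⊗ₖ X i) ^ k = ∑ j, mconj (P j) ⊗ₖ P j ∧
      (∑ i, mconj (Y i) ⊗ₖ Y i) ^ k = ∑ j, mconj (Q j) ⊗ₖ Q j := by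
  have step : ∀ {J : Type u} [Fintype J] (P Q : J → Matrix n n ℂ) (Z W : ι → Matrix n n ℂ),
      (∑ j, mconj (P j) ⊗ₖ Q j) * (∑ i, mconj (Z i) ⊗ₖ W i) =
        ∑ p : J × ι, mconj (P p.1 * Z p.2) ⊗ₖ (Q p.1 * W p.2) := by
    intro J _ P Q Z W
    rw [Finset.sum_mul_sum, Fintype.sum_prod_type]
    simp only [mconj_mul, Matrix.mul_kronecker_mul]
  induction k with
  | zero =>
    refine ⟨PUnit.{u + 1}, inferInstance, fun _ => 1, fun _ => 1, ?_⟩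
    simp [mconj_one]
  | succ k ih =>
    obtain ⟨J, _, P, Q, h1, h2, h3⟩ := ih
    refine ⟨J × ι, inferInstance, fun p => P p.1 * X p.2, fun p => Q p.1 * Y p.2, ?_, ?_, ?_⟩
    · rw [pow_succ, h1, step]
    · rw [pow_succ, h2, step]
    · rw [pow_succ, h3, step]

lemma re_trace_kronecker_self (P : ι → Matrix n n ℂ) :
    (∑ j, mconj (P j) ⊗ₖ P j).trace.re = ∑ j, ‖(P j).trace‖ ^ 2 := by
  simp only [Matrix.trace_sum, Matrix.trace_kronecker, trace_mconj, Complex.conj_mul',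
    Complex.re_sum]
  norm_cast

/-- Cauchy-Schwarz for the traces of powers of `∑ conj X ⊗ Y`. -/
lemma norm_trace_kronecker_pow_sq_le [DecidableEq n] (X Y : ι → Matrix n n ℂ) (k : ℕ) :
    ‖((∑ i, mconj (X i) ⊗ₖ Y i) ^ k).trace‖ ^ 2 ≤
      ((∑ i, mconj (X i) ⊗ₖ X i) ^ k).trace.re * ((∑ i, mconj (Y i) ⊗ₖ Y i) ^ k).trace.re := by
  obtain ⟨J, _, P, Q, h1, h2, h3⟩ := exists_kronecker_sum_pow X Y k
  rw [h1, h2, h3, re_trace_kronecker_self, re_trace_kronecker_self]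
  refine le_trans ?_ (Finset.sum_mul_sq_le_sq_mul_sq Finset.univ
    (fun j => ‖(P j).trace‖) (fun j => ‖(Q j).trace‖))
  gcongr
  rw [Matrix.trace_sum]
  refine (norm_sum_le _ _).trans (Finset.sum_le_sum fun j _ => ?_)
  rw [Matrix.trace_kronecker, trace_mconj, norm_mul, RCLike.norm_conj]

lemma posSemidef_sum_kronecker {X Y : ι → Matrix n n ℂ} (hX : ∀ i, (X i).PosSemidef)
    (hY : ∀ i, (Y i).PosSemidef) : (∑ i, mconj (X i) ⊗ₖ Y i).PosSemidef :=
  Matrix.posSemidef_sum _ fun i _ => (hX i).mconj.kronecker (hY i)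

/-- Operator-norm Cauchy-Schwarz inequality for sums of tensor products of positive
semidefinite matrices. -/
lemma norm_sum_kronecker_sq_le [DecidableEq n] {X Y : ι → Matrix n n ℂ} (hX : ∀ i, (X i).PosSemidef)
    (hY : ∀ i, (Y i).PosSemidef) :
    ‖∑ i, mconj (X i) ⊗ₖ Y i‖ ^ 2 ≤
      ‖∑ i, mconj (X i) ⊗ₖ X i‖ * ‖∑ i, mconj (Y i) ⊗ₖ Y i‖ := by
  have hM := posSemidef_sum_kronecker hX hY
  have hP := posSemidef_sum_kronecker hX hX
  have hQ := posSemidef_sum_kronecker hY hY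
  have hcs := norm_trace_kronecker_pow_sq_le X Y
  set M := ∑ i, mconj (X i) ⊗ₖ Y i
  set P := ∑ i, mconj (X i) ⊗ₖ X i
  set Q := ∑ i, mconj (Y i) ⊗ₖ Y i
  have norm_pow : ∀ {N : Matrix (n × n) (n × n) ℂ}, N.PosSemidef → ∀ k : ℕ,
      ‖N ^ 2 ^ k‖ = ‖N‖ ^ 2 ^ k := fun hN k =>
    congrArg NNReal.toReal (IsSelfAdjoint.nnnorm_pow_two_pow hN.1 k)
  have upper : ∀ {N : Matrix (n × n) (n × n) ℂ}, N.PosSemidef → ∀ k : ℕ,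
      (N ^ 2 ^ k).trace.re ≤ Fintype.card (n × n) * ‖N‖ ^ 2 ^ k := fun hN k =>
    norm_pow hN k ▸ (hN.pow _).1.trace_re_le_card_mul_norm
  refine le_of_forall_pow_two_pow_le (C := (Fintype.card (n × n) : ℝ) ^ 2) (by positivity)
    fun k => ?_
  calc (‖M‖ ^ 2) ^ 2 ^ k = ‖M ^ 2 ^ k‖ ^ 2 := by rw [norm_pow hM, pow_right_comm]
    _ ≤ ‖(M ^ 2 ^ k).trace‖ ^ 2 := by
      gcongr
      exact (hM.pow _).norm_le_trace.trans (Complex.re_le_norm _)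
    _ ≤ (P ^ 2 ^ k).trace.re * (Q ^ 2 ^ k).trace.re := hcs _
    _ ≤ (Fintype.card (n × n) * ‖P‖ ^ 2 ^ k) * (Fintype.card (n × n) * ‖Q‖ ^ 2 ^ k) :=
      mul_le_mul (upper hP k) (upper hQ k)
        (Complex.le_def.1 (hQ.pow _).trace_nonneg).1 (by positivity)
    _ = (Fintype.card (n × n) : ℝ) ^ 2 * (‖P‖ * ‖Q‖) ^ 2 ^ k := by ring

end CauchySchwarz

lemma Matrix.kronecker_mono {m n : Type*} [Fintype m] [Fintype n] {A : Matrix m m ℂ}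
    {B C : Matrix n n ℂ} (hA : A.PosSemidef) (h : B ≤ C) : A ⊗ₖ B ≤ A ⊗ₖ C := by
  rw [Matrix.le_iff]
  have : A ⊗ₖ C - A ⊗ₖ B = A ⊗ₖ (C - B) := by
    ext i j
    simp [mul_sub]
  rw [this]
  exact hA.kronecker (Matrix.le_iff.1 h)

lemma mconj_kronecker_mono_left {m n : Type*} [Fintype m] [Fintype n] {A B : Matrix m m ℂ}
    {C : Matrix n n ℂ} (hC : C.PosSemidef) (h : A ≤ B) : mconj A ⊗ₖ C ≤ mconj B ⊗ₖ C := by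
  rw [Matrix.le_iff]
  have : mconj B ⊗ₖ C - mconj A ⊗ₖ C = mconj (B - A) ⊗ₖ C := by
    ext i j
    simp [mconj, sub_mul]
  rw [this]
  exact (Matrix.le_iff.1 h).mconj.kronecker hC

lemma IsPOVM.le_one {d : ℕ} {α : Type*} [Fintype α] {M : α → Mat d} (hM : IsPOVM M) (a : α) :
    M a ≤ 1 := by
  rw [← hM.2]
  exact Finset.single_le_sum (fun b _ => Matrix.nonneg_iff_posSemidef.2 (hM.1 b))
    (Finset.mem_univ a)

lemma IsPOVM.sum_kronecker_self_le_one {d : ℕ} {α : Type*} [Fintype α] {M : α → Mat d}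
    (hM : IsPOVM M) : ∑ a, mconj (M a) ⊗ₖ M a ≤ 1 := by
  calc ∑ a, mconj (M a) ⊗ₖ M a ≤ ∑ a, mconj (M a) ⊗ₖ (1 : Mat d) :=
        Finset.sum_le_sum fun a _ => Matrix.kronecker_mono (hM.1 a).mconj (hM.le_one a)
    _ = mconj (∑ a, M a) ⊗ₖ (1 : Mat d) := by
        ext i j
        simp [mconj_sum, Matrix.sum_apply, Finset.sum_mul]
    _ = 1 := by rw [hM.2, mconj_one, Matrix.one_kronecker_one]

namespace ProjGame

variable (G : ProjGame) {d : ℕ}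

lemma μL_nonneg (u : G.U) : 0 ≤ G.μL u := Finset.sum_nonneg fun v _ => G.μ_nonneg u v

lemma μc_nonneg (u : G.U) (v : G.V) : 0 ≤ G.μc u v :=
  div_nonneg (G.μ_nonneg u v) (G.μL_nonneg u)

lemma sum_μc_le_one (u : G.U) : ∑ v, G.μc u v ≤ 1 := by
  simp only [μc, ← Finset.sum_div]
  exact div_self_le_one (G.μL u)

variable {G} {B : G.V → G.B → Mat d}

lemma IsStrategyB.posSemidef_Bop (hB : G.IsStrategyB B) (u : G.U) (a : G.A) :
    (G.Bop B u a).PosSemidef := by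
  refine Matrix.posSemidef_sum _ fun v _ => Matrix.posSemidef_sum _ fun b _ => ?_
  split_ifs
  · exact ((hB v).1 b).smul (Complex.zero_le_real.2 (G.μc_nonneg u v))
  · exact Matrix.PosSemidef.zero

lemma IsStrategyB.sum_Bop_le_one (hB : G.IsStrategyB B) (u : G.U) :
    ∑ a, G.Bop B u a ≤ 1 := by
  have hnn : ∀ v b, 0 ≤ (G.μc u v : ℂ) • B v b := fun v b => Matrix.nonneg_iff_posSemidef.2
    (((hB v).1 b).smul (Complex.zero_le_real.2 (G.μc_nonneg u v)))
  calc ∑ a, G.Bop B u a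
      = ∑ v, ∑ b, ∑ a, if G.proj u v b = some a then (G.μc u v : ℂ) • B v b else 0 := by
        simp only [Bop]
        rw [Finset.sum_comm]
        exact Finset.sum_congr rfl fun v _ => Finset.sum_comm
    _ ≤ ∑ v, ∑ b, (G.μc u v : ℂ) • B v b := by
        refine Finset.sum_le_sum fun v _ => Finset.sum_le_sum fun b _ => ?_
        cases h : G.proj u v b with
        | none => simpa using hnn v b
        | some a => simp
    _ = ((∑ v, G.μc u v : ℝ) : ℂ) • (1 : Mat d) := by
        simp only [← Finset.smul_sum, (hB _).2, ← Finset.sum_smul]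
        push_cast
        rfl
    _ ≤ 1 := by
        rw [Matrix.le_iff]
        have : (1 : Mat d) - ((∑ v, G.μc u v : ℝ) : ℂ) • (1 : Mat d)
            = ((1 - ∑ v, G.μc u v : ℝ) : ℂ) • (1 : Mat d) := by
          push_cast
          rw [sub_smul, one_smul]
        rw [this]
        exact Matrix.PosSemidef.one.smul
          (Complex.zero_le_real.2 (sub_nonneg.2 (G.sum_μc_le_one u)))

variable (G) in
lemma sum_smul_kronecker_eq (X Y : G.U → G.A → Mat d) :
    ∑ u, (G.μL u : ℂ) • ∑ a, mconj (X u a) ⊗ₖ Y u a =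
      ∑ p : G.U × G.A, mconj (((√(G.μL p.1) : ℝ) : ℂ) • X p.1 p.2) ⊗ₖ
        (((√(G.μL p.1) : ℝ) : ℂ) • Y p.1 p.2) := by
  rw [Fintype.sum_prod_type]
  refine Finset.sum_congr rfl fun u _ => ?_
  rw [Finset.smul_sum]
  refine Finset.sum_congr rfl fun a _ => ?_
  rw [mconj_smul_ofReal, Matrix.smul_kronecker, Matrix.kronecker_smul, smul_smul,
    ← Complex.ofReal_mul, Real.mul_self_sqrt (G.μL_nonneg u)]

variable (G) in
lemma sum_smul_mono {m : Type*} [Fintype m] {M N : G.U → Matrix m m ℂ} (h : ∀ u, M u ≤ N u) :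
    ∑ u, (G.μL u : ℂ) • M u ≤ ∑ u, (G.μL u : ℂ) • N u := by
  refine Finset.sum_le_sum fun u _ => ?_
  rw [Matrix.le_iff, ← smul_sub]
  exact (Matrix.le_iff.1 (h u)).smul (Complex.zero_le_real.2 (G.μL_nonneg u))

lemma IsStrategyA.norm_sum_kronecker_self_le_one {A : G.U → G.A → Mat d}
    (hA : G.IsStrategyA A) :
    ‖∑ u, (G.μL u : ℂ) • ∑ a, mconj (A u a) ⊗ₖ A u a‖ ≤ 1 := by
  have h0 : 0 ≤ ∑ u, (G.μL u : ℂ) • ∑ a, mconj (A u a) ⊗ₖ A u a := by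
    refine le_trans (by simp) (G.sum_smul_mono (M := fun _ => 0) fun u => ?_)
    exact Matrix.nonneg_iff_posSemidef.2 (posSemidef_sum_kronecker (hA u).1 (hA u).1)
  have h1 : ∑ u, (G.μL u : ℂ) • ∑ a, mconj (A u a) ⊗ₖ A u a ≤ 1 := by
    refine (G.sum_smul_mono fun u => (hA u).sum_kronecker_self_le_one).trans (le_of_eq ?_)
    rw [← Finset.sum_smul, ← Complex.ofReal_sum]
    have : ∑ u, G.μL u = 1 := G.μ_sum
    rw [this, Complex.ofReal_one, one_smul]
  exact (CStarAlgebra.norm_le_norm_of_nonneg_of_le h0 h1).trans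
    (by
      rw [← diagonal_one, Matrix.l2_opNorm_diagonal]
      exact (pi_norm_le_iff_of_nonneg zero_le_one).2 (by simp))

/-- The value of any first-player strategy against `B` is at most the square root of
`‖sqMat B‖`. -/
lemma IsStrategyB.sq_opNorm_le (hB : G.IsStrategyB B) {A : G.U → G.A → Mat d}
    (hA : G.IsStrategyA A) :
    opNorm (∑ u, (G.μL u : ℂ) • ∑ a, mconj (A u a) ⊗ₖ G.Bop B u a) ^ 2
      ≤ opNorm (G.sqMat B) := by
  have hpos : ∀ {X : G.U → G.A → Mat d}, (∀ u a, (X u a).PosSemidef) → ∀ p : G.U × G.A,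
      (((√(G.μL p.1) : ℝ) : ℂ) • X p.1 p.2).PosSemidef := fun hX p =>
    (hX p.1 p.2).smul (Complex.zero_le_real.2 (Real.sqrt_nonneg _))
  have h := norm_sum_kronecker_sq_le (hpos fun u => (hA u).1) (hpos hB.posSemidef_Bop)
  rw [← G.sum_smul_kronecker_eq A (G.Bop B), ← G.sum_smul_kronecker_eq A A,
    ← G.sum_smul_kronecker_eq (G.Bop B) (G.Bop B)] at h
  exact h.trans (mul_le_of_le_one_left (norm_nonneg _) hA.norm_sum_kronecker_self_le_one)

/-- The operators `B_u^a` are dominated by a strategy of the first player. -/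
lemma IsStrategyB.exists_strategyA_ge [Nonempty G.A] (hB : G.IsStrategyB B) :
    ∃ A : G.U → G.A → Mat d, G.IsStrategyA A ∧ ∀ u a, G.Bop B u a ≤ A u a := by
  obtain ⟨a₀⟩ := ‹Nonempty G.A›
  have hnn : ∀ u a, 0 ≤ if a = a₀ then 1 - ∑ a', G.Bop B u a' else 0 := by
    intro u a
    split_ifs
    · exact sub_nonneg.2 (hB.sum_Bop_le_one u)
    · exact le_rfl
  refine ⟨fun u a => G.Bop B u a + if a = a₀ then 1 - ∑ a', G.Bop B u a' else 0,
    fun u => ⟨fun a => ?_, ?_⟩, fun u a => le_add_of_nonneg_right (hnn u a)⟩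
  · exact (hB.posSemidef_Bop u a).add (Matrix.nonneg_iff_posSemidef.1 (hnn u a))
  · simp [Finset.sum_add_distrib]

end ProjGame


/-- For a fixed second-player strategy `B`, the square norm quantity
`‖Σ_u μ(u) Σ_a conj(B_u^a) ⊗ B_u^a‖` is squeezed between the square and the first power
of the best-response value `sup_A val*(G,A,B)`. -/
theorem best_response (G : ProjGame) (d : ℕ) (B : G.V → G.B → Mat d)
    (hB : G.IsStrategyB B) :
    sSup { x | ∃ A : G.U → G.A → Mat d, G.IsStrategyA A ∧
        x = opNorm (∑ u, (G.μL u : ℂ) • ∑ a, mconj (A u a) ⊗ₖ G.Bop B u a) } ^ 2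
      ≤ opNorm (G.sqMat B) ∧
    opNorm (G.sqMat B)
      ≤ sSup { x | ∃ A : G.U → G.A → Mat d, G.IsStrategyA A ∧
        x = opNorm (∑ u, (G.μL u : ℂ) • ∑ a, mconj (A u a) ⊗ₖ G.Bop B u a) } := by
  set S := { x | ∃ A : G.U → G.A → Mat d, G.IsStrategyA A ∧
        x = opNorm (∑ u, (G.μL u : ℂ) • ∑ a, mconj (A u a) ⊗ₖ G.Bop B u a) }
  have hbd : ∀ x ∈ S, x ≤ √(opNorm (G.sqMat B)) := by
    rintro x ⟨A, hA, rfl⟩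
    exact Real.le_sqrt_of_sq_le (hB.sq_opNorm_le hA)
  have hnn : ∀ x ∈ S, 0 ≤ x := by
    rintro x ⟨A, hA, rfl⟩
    exact norm_nonneg _
  refine ⟨?_, ?_⟩
  · calc sSup S ^ 2 ≤ √(opNorm (G.sqMat B)) ^ 2 :=
          pow_le_pow_left₀ (Real.sSup_nonneg hnn) (Real.sSup_le hbd (Real.sqrt_nonneg _)) 2
      _ = opNorm (G.sqMat B) := Real.sq_sqrt (norm_nonneg _)
  · rcases isEmpty_or_nonempty G.A with hE | hE
    · have : opNorm (G.sqMat B) = 0 := by simp [ProjGame.sqMat, opNorm]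
      rw [this]
      exact Real.sSup_nonneg hnn
    · obtain ⟨A, hA, hle⟩ := hB.exists_strategyA_ge
      refine le_trans ?_ (le_csSup ⟨_, hbd⟩ ⟨A, hA, rfl⟩)
      refine CStarAlgebra.norm_le_norm_of_nonneg_of_le (A := Matrix (Fin d × Fin d) (Fin d × Fin d) ℂ) ?_ ?_
      · refine le_trans (by simp) (G.sum_smul_mono (M := fun _ => 0) fun u => ?_)
        exact Matrix.nonneg_iff_posSemidef.2
          (posSemidef_sum_kronecker (hB.posSemidef_Bop u) (hB.posSemidef_Bop u))
      · exact G.sum_smul_mono fun u => Finset.sum_le_sum fun a _ =>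
          mconj_kronecker_mono_left (hB.posSemidef_Bop u a) (hle u a)
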